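/- Let p be a prime, k a field, and (A_i, φ_{ij}) a filtered (directed) system of commutative k-algebras each of which is finite-dimensional as a k-vector space, whose colimit A in the category of commutative k-algebras is also finite-dimensional over k. Then the canonical ring homomorphism colim_i W(A_i) → W(A), induced by applying the p-typical Witt vector functor W (which acts coefficientwise on Witt vectors via the structure maps) to the colimit cocone, is bijective. -/

import Mathlib

/-- A directed system of modules whose colimit is finite has a term mapping onto the colimit. -/
theorem exists_surjective_of_finite {R ι : Type*} [Semiring R] [Preorder ι]
    [IsDirected ι (· ≤ ·)] [Nonempty ι] {M : ι → Type*} [∀ i, AddCommMonoid (M i)]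
    [∀ i, Module R (M i)] (f : ∀ ⦃i j : ι⦄, i ≤ j → (M i →ₗ[R] M j))
    {N : Type*} [AddCommMonoid N] [Module R N] [Module.Finite R N] (g : ∀ i, M i →ₗ[R] N)
    (hcomp : ∀ (i j : ι) (h : i ≤ j) (x : M i), g j (f h x) = g i x)
    (hsurj : ∀ a : N, ∃ i x, g i x = a) :
    ∃ i, Function.Surjective (g i) := by
  classical
  obtain ⟨s, hs⟩ := Module.Finite.fg_top (R := R) (M := N)
  choose i x hx using hsurj
  obtain ⟨m, hm⟩ := (s.image i).exists_le
  refine ⟨m, LinearMap.range_eq_top.mp (top_le_iff.mp ?_)⟩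
  rw [← hs, Submodule.span_le]
  intro a ha
  have hle : i a ≤ m := hm _ (Finset.mem_image_of_mem i ha)
  exact ⟨f hle (x a), by rw [hcomp, hx]⟩

/-- In a directed system of modules, a finitely generated submodule whose elements all
eventually vanish is killed by a single transition map. -/
theorem exists_le_ker_of_fg {R ι : Type*} [Semiring R] [Preorder ι]
    [IsDirected ι (· ≤ ·)] {M : ι → Type*} [∀ i, AddCommMonoid (M i)]
    [∀ i, Module R (M i)] (f : ∀ ⦃i j : ι⦄, i ≤ j → (M i →ₗ[R] M j))
    (hf : ∀ (i j l : ι) (hij : i ≤ j) (hjl : j ≤ l) (x : M i),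
      f hjl (f hij x) = f (hij.trans hjl) x)
    {i : ι} {K : Submodule R (M i)} (hK : K.FG)
    (hzero : ∀ x ∈ K, ∃ j, ∃ h : i ≤ j, f h x = 0) :
    ∃ j, ∃ h : i ≤ j, K ≤ LinearMap.ker (f h) := by
  classical
  have : Nonempty ι := ⟨i⟩
  obtain ⟨s, rfl⟩ := hK
  choose j hj hx using hzero
  obtain ⟨m, hm⟩ :=
    (insert i (s.attach.image fun x : s => j x (Submodule.subset_span x.2))).exists_le
  refine ⟨m, hm _ (Finset.mem_insert_self _ _), ?_⟩
  rw [Submodule.span_le]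
  intro x hxs
  have hle : j x (Submodule.subset_span hxs) ≤ m :=
    hm _ (Finset.mem_insert_of_mem (Finset.mem_image_of_mem _ (Finset.mem_attach s ⟨x, hxs⟩)))
  change f _ x = 0
  rw [← hf i _ m (hj x (Submodule.subset_span hxs)) hle, hx, map_zero]

/-- Let `p` be a prime, `k` a field, and `(A i, φ)` a filtered (directed) system of
commutative `k`-algebras, each finite-dimensional over `k`, whose colimit `Alim` in
the category of commutative `k`-algebras (characterized by the cocone `ψ` being
jointly surjective with eventual equality of identified elements, the concrete
description of a filtered colimit of algebras) is also finite-dimensional over `k`.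
Then the canonical ring homomorphism `colim_i W(A i) → W(Alim)`, induced by
applying the `p`-typical Witt vector functor `W` to the colimit cocone, is
bijective. -/
theorem stmt_0 (p : ℕ) [Fact p.Prime] (k : Type*) [Field k]
    {ι : Type*} [Preorder ι] [IsDirected ι (· ≤ ·)] [Nonempty ι]
    (A : ι → Type*) [∀ i, CommRing (A i)] [∀ i, Algebra k (A i)]
    [∀ i, FiniteDimensional k (A i)]
    (φ : ∀ ⦃i j : ι⦄, i ≤ j → (A i →ₐ[k] A j))
    (hφrefl : ∀ (i : ι) (x : A i), φ (le_refl i) x = x)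
    (hφtrans : ∀ (i j l : ι) (hij : i ≤ j) (hjl : j ≤ l) (x : A i),
      φ hjl (φ hij x) = φ (hij.trans hjl) x)
    (Alim : Type*) [CommRing Alim] [Algebra k Alim] [FiniteDimensional k Alim]
    (ψ : ∀ i, A i →ₐ[k] Alim)
    (hcomp : ∀ (i j : ι) (h : i ≤ j), (ψ j).comp (φ h) = ψ i)
    (hsurj : ∀ a : Alim, ∃ i x, ψ i x = a)
    (hinj : ∀ (i : ι) (x y : A i), ψ i x = ψ i y → ∃ j, ∃ h : i ≤ j, φ h x = φ h y) :
    Function.Bijective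
      (Ring.DirectLimit.lift (fun i => WittVector p (A i))
        (fun i j hij => (WittVector.map (φ hij).toRingHom :
          WittVector p (A i) → WittVector p (A j)))
        (WittVector p Alim)
        (fun i => WittVector.map (ψ i).toRingHom)
        (fun i j hij x =>
          WittVector.ext fun n => by
            simpa [WittVector.map_coeff] using
              DFunLike.congr_fun (hcomp i j hij) (x.coeff n))) := by
  constructor
  · rw [injective_iff_map_eq_zero]
    intro z hz
    obtain ⟨i, w, rfl⟩ := Ring.DirectLimit.exists_of z
    rw [Ring.DirectLimit.lift_of] at hz
    obtain ⟨j, hij, hker⟩ := exists_le_ker_of_fg (fun i j h => (φ (i := i) (j := j) h).toLinearMap)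
      hφtrans (IsNoetherian.noetherian (LinearMap.ker (ψ i).toLinearMap)) fun x hx => by
        obtain ⟨j, h, e⟩ := hinj i x 0 (by simpa using hx)
        exact ⟨j, h, by simpa using e⟩
    have hw : WittVector.map (φ hij).toRingHom w = 0 := by
      ext n
      have hn : ψ i (w.coeff n) = 0 := by
        simpa [WittVector.map_coeff] using congrArg (fun v => WittVector.coeff v n) hz
      simpa [WittVector.map_coeff] using hker (x := w.coeff n) hn
    rw [← Ring.DirectLimit.of_f hij, hw, map_zero]
  · obtain ⟨i, hi⟩ := exists_surjective_of_finite
      (fun i j h => (φ (i := i) (j := j) h).toLinearMap) (fun i => (ψ i).toLinearMap)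
      (fun i j h x => DFunLike.congr_fun (hcomp i j h) x) hsurj
    intro a
    obtain ⟨w, rfl⟩ := WittVector.map_surjective (ψ i).toRingHom hi a
    exact ⟨Ring.DirectLimit.of _ _ i w, Ring.DirectLimit.lift_of ..⟩
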